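/- arXiv:1905.04512 — 2 statements merged into one kernel-verified Lean document; each statement's English description precedes it below -/
import Mathlib

section
/- On the open region U = {(x,y,z) ∈ ℝ³ : x ≠ 0}, the vector fields X₁ = (−1, (y − 1 + e^{x})/x, (2e^{x} + 2y − 2)/x), X₂ = (0, e^{x}, e^{x}(1 − x)), X₃ = (0, −e^{x}/x, e^{x}(x − 2)/x) satisfy [X₁, X₂] = −(X₂ − X₃) and [X₁, X₃] = −X₃ on U, so they span a three-dimensional Lie algebra of Bianchi type IV. -/
open Real

/-- The Lie bracket of vector fields on (an open subset of) `ℝ³`: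
`[X,Y](p) = DY(p)(X(p)) − DX(p)(Y(p))`. -/
noncomputable def lieBr (X Y : (Fin 3 → ℝ) → (Fin 3 → ℝ)) (p : Fin 3 → ℝ) : Fin 3 → ℝ :=
  fderiv ℝ Y p (X p) - fderiv ℝ X p (Y p)

/-- X₁ = (−1, (y − 1 + e^{x})/x, (2e^{x} + 2y − 2)/x). -/
noncomputable def X₁ : (Fin 3 → ℝ) → (Fin 3 → ℝ) := fun p =>
  ![-1, (p 1 - 1 + exp (p 0)) / p 0, (2 * exp (p 0) + 2 * p 1 - 2) / p 0]

/-- X₂ = (0, e^{x}, e^{x}(1 − x)). -/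
noncomputable def X₂ : (Fin 3 → ℝ) → (Fin 3 → ℝ) := fun p =>
  ![0, exp (p 0), exp (p 0) * (1 - p 0)]

/-- X₃ = (0, −e^{x}/x, e^{x}(x − 2)/x). -/
noncomputable def X₃ : (Fin 3 → ℝ) → (Fin 3 → ℝ) := fun p =>
  ![0, -(exp (p 0) / p 0), exp (p 0) * (p 0 - 2) / p 0]

/-- The derivative of a vector field on `ℝ³`, from the derivatives of its components. -/
theorem hasFDerivAt_vec3 {f g h : (Fin 3 → ℝ) → ℝ} {p : Fin 3 → ℝ}
    {f' g' h' : (Fin 3 → ℝ) →L[ℝ] ℝ}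
    (hf : HasFDerivAt f f' p) (hg : HasFDerivAt g g' p) (hh : HasFDerivAt h h' p) :
    HasFDerivAt (fun q => ![f q, g q, h q]) (ContinuousLinearMap.pi ![f', g', h']) p := by
  rw [hasFDerivAt_pi']
  intro i
  fin_cases i
  · exact hf
  · exact hg
  · exact hh

theorem hasFDerivAt_coord (i : Fin 3) (p : Fin 3 → ℝ) :
    HasFDerivAt (fun q : Fin 3 → ℝ => q i) (ContinuousLinearMap.proj (R := ℝ) i) p :=
  hasFDerivAt_apply i p

theorem HasFDerivAt.fun_div_real {E : Type*} [NormedAddCommGroup E] [NormedSpace ℝ E]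
    {f g : E → ℝ} {f' g' : E →L[ℝ] ℝ} {p : E} (hf : HasFDerivAt f f' p)
    (hg : HasFDerivAt g g' p) (hp : g p ≠ 0) :
    HasFDerivAt (fun q => f q / g q) ((g p)⁻¹ • f' - (f p / g p ^ 2) • g') p := by
  have h := hf.mul ((hasDerivAt_inv hp).comp_hasFDerivAt p hg)
  convert! h using 1
  ext v
  simp
  ring

theorem fderiv_X₁ {p : Fin 3 → ℝ} (hp : p 0 ≠ 0) (v : Fin 3 → ℝ) :
    fderiv ℝ X₁ p v =
      ![0, (v 1 + exp (p 0) * v 0) / p 0 - (p 1 - 1 + exp (p 0)) * v 0 / p 0 ^ 2,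
        (2 * exp (p 0) * v 0 + 2 * v 1) / p 0
          - (2 * exp (p 0) + 2 * p 1 - 2) * v 0 / p 0 ^ 2] := by
  have hx := hasFDerivAt_coord 0 p
  have hy := hasFDerivAt_coord 1 p
  have h := hasFDerivAt_vec3 (hasFDerivAt_const (-1 : ℝ) p)
    (((hy.sub_const 1).add hx.exp).fun_div_real hx hp)
    ((((hx.exp.const_mul 2).add (hy.const_mul 2)).sub_const 2).fun_div_real hx hp)
  rw [HasFDerivAt.fderiv (f := X₁) h]
  ext i
  fin_cases i <;> simp <;> field_simp

theorem fderiv_X₂ (p v : Fin 3 → ℝ) :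
    fderiv ℝ X₂ p v = ![0, exp (p 0) * v 0, -(p 0 * exp (p 0) * v 0)] := by
  have hx := hasFDerivAt_coord 0 p
  have h := hasFDerivAt_vec3 (hasFDerivAt_const (0 : ℝ) p) hx.exp
    (hx.exp.mul (hx.const_sub 1))
  rw [HasFDerivAt.fderiv (f := X₂) h]
  ext i
  fin_cases i <;> simp
  ring

theorem fderiv_X₃ {p : Fin 3 → ℝ} (hp : p 0 ≠ 0) (v : Fin 3 → ℝ) :
    fderiv ℝ X₃ p v =
      ![0, -(exp (p 0) * (p 0 - 1) * v 0 / p 0 ^ 2),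
        exp (p 0) * (p 0 ^ 2 - 2 * p 0 + 2) * v 0 / p 0 ^ 2] := by
  have hx := hasFDerivAt_coord 0 p
  have h := hasFDerivAt_vec3 (hasFDerivAt_const (0 : ℝ) p) (hx.exp.fun_div_real hx hp).neg
    ((hx.exp.mul (hx.sub_const 2)).fun_div_real hx hp)
  rw [HasFDerivAt.fderiv (f := X₃) h]
  ext i
  fin_cases i <;> simp <;> field_simp <;> ring

/-- On the open region `U = {(x,y,z) : x ≠ 0}` the vector fields `X₁, X₂, X₃`
satisfy `[X₁, X₂] = −(X₂ − X₃)` and `[X₁, X₃] = −X₃`, so they span a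
three-dimensional Lie algebra of Bianchi type IV. -/
theorem stmt_13 (p : Fin 3 → ℝ) (hp : p ∈ {q : Fin 3 → ℝ | q 0 ≠ 0}) :
    lieBr X₁ X₂ p = -(X₂ p - X₃ p) ∧
    lieBr X₁ X₃ p = -X₃ p := by
  have hx : p 0 ≠ 0 := hp
  constructor <;> ext i <;> fin_cases i <;>
    simp [lieBr, fderiv_X₁ hx, fderiv_X₂, fderiv_X₃ hx, X₁, X₂, X₃] <;> field_simp <;> ring
end

section
/- Fix a real constant b ≠ 0 and work on U = {(x,y,z) ∈ ℝ³ : x > 0}. With the Jacobi structure Λ^{12} = ½(1 − e^{b(y−z)}), Λ^{13} = −½(1 − e^{b(y−z)}), Λ^{23} = (y+z)·e^{b(y−z)}, E = (−b, 0, 0), the functions f₁ = x and f₂ = −x·ln(x)/b satisfy {f₁, f₂} = f₁ on U, and the function h = 1 − e^{−b(y−z)} satisfies {h, f₁} = 0 and {h, f₂} = 0 on U; i.e., h is a t-independent constant of motion for the Lie system X = b₁(t)X_{f₁} + b₂(t)X_{f₂}. -/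
open Real

/-- Partial derivative `∂_μ f` on `ℝ³`. -/
noncomputable def pd (μ : Fin 3) (f : (Fin 3 → ℝ) → ℝ) (p : Fin 3 → ℝ) : ℝ :=
  fderiv ℝ f p (Pi.single μ 1)

/-- The Jacobi bracket of `f, g`:
`{f,g} = Σ_{μ,ν} Λ^{μν}·(∂_μ f)·(∂_ν g) + f·(Eg) − g·(Ef)`. -/
noncomputable def jb (Λ : (Fin 3 → ℝ) → Fin 3 → Fin 3 → ℝ)
    (E : (Fin 3 → ℝ) → Fin 3 → ℝ) (f g : (Fin 3 → ℝ) → ℝ) (p : Fin 3 → ℝ) : ℝ :=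
  (∑ μ : Fin 3, ∑ ν : Fin 3, Λ p μ ν * pd μ f p * pd ν g p)
    + f p * (∑ μ : Fin 3, E p μ * pd μ g p)
    - g p * (∑ μ : Fin 3, E p μ * pd μ f p)

/-- The bivector with `Λ^{12} = ½(1 − e^{b(y−z)})`, `Λ^{13} = −½(1 − e^{b(y−z)})`,
`Λ^{23} = (y+z)·e^{b(y−z)}`. -/
noncomputable def Lam (b : ℝ) : (Fin 3 → ℝ) → Fin 3 → Fin 3 → ℝ := fun p =>
  ![![0, (1 - exp (b * (p 1 - p 2))) / 2, -((1 - exp (b * (p 1 - p 2))) / 2)],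
    ![-((1 - exp (b * (p 1 - p 2))) / 2), 0, (p 1 + p 2) * exp (b * (p 1 - p 2))],
    ![(1 - exp (b * (p 1 - p 2))) / 2, -((p 1 + p 2) * exp (b * (p 1 - p 2))), 0]]

/-- The Reeb vector field `E = (−b, 0, 0)`. -/
noncomputable def Evec (b : ℝ) : (Fin 3 → ℝ) → Fin 3 → ℝ := fun _ => ![-b, 0, 0]

/-- f₁ = x. -/
noncomputable def f₁ : (Fin 3 → ℝ) → ℝ := fun q => q 0

/-- f₂ = −x·ln(x)/b. -/
noncomputable def f₂ (b : ℝ) : (Fin 3 → ℝ) → ℝ := fun q => -(q 0 * Real.log (q 0) / b)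

/-- h = 1 − e^{−b(y−z)}. -/
noncomputable def h (b : ℝ) : (Fin 3 → ℝ) → ℝ := fun q => 1 - exp (-b * (q 1 - q 2))

theorem pd_eq_of_hasFDerivAt {f : (Fin 3 → ℝ) → ℝ} {f' : (Fin 3 → ℝ) →L[ℝ] ℝ} {p : Fin 3 → ℝ}
    (hf : HasFDerivAt f f' p) (μ : Fin 3) : pd μ f p = f' (Pi.single μ 1) := by
  rw [pd, hf.fderiv]

theorem pd_f₁ (μ : Fin 3) (p : Fin 3 → ℝ) : pd μ f₁ p = ![1, 0, 0] μ := by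
  rw [pd_eq_of_hasFDerivAt (f := f₁) (hasFDerivAt_apply 0 p)]
  fin_cases μ <;> simp

theorem pd_f₂ (b : ℝ) (μ : Fin 3) {p : Fin 3 → ℝ} (hp : p 0 ≠ 0) :
    pd μ (f₂ b) p = ![-((Real.log (p 0) + 1) / b), 0, 0] μ := by
  have hx : HasFDerivAt (fun q : Fin 3 → ℝ => q 0)
      (ContinuousLinearMap.proj 0 : (Fin 3 → ℝ) →L[ℝ] ℝ) p := hasFDerivAt_apply 0 p
  have hf : HasFDerivAt (f₂ b) _ p :=
    HasDerivAt.comp_hasFDerivAt (h₂ := fun x => -(x * Real.log x / b)) p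
      ((Real.hasDerivAt_mul_log hp).div_const b).neg hx
  rw [pd_eq_of_hasFDerivAt hf]
  fin_cases μ <;> simp

theorem pd_h (b : ℝ) (μ : Fin 3) (p : Fin 3 → ℝ) :
    pd μ (h b) p =
      ![0, b * exp (-b * (p 1 - p 2)), -(b * exp (-b * (p 1 - p 2)))] μ := by
  have hf : HasFDerivAt (h b) _ p :=
    ((((hasFDerivAt_apply 1 p).sub (hasFDerivAt_apply 2 p)).const_mul (-b)).exp).const_sub 1
  rw [pd_eq_of_hasFDerivAt hf]
  fin_cases μ <;> simp [mul_comm]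

/-- For `b ≠ 0`, on `U = {(x,y,z) : x > 0}` with the Jacobi structure `(Λ, E)`
above, the functions `f₁ = x` and `f₂ = −x·ln(x)/b` satisfy `{f₁, f₂} = f₁`,
and `h = 1 − e^{−b(y−z)}` satisfies `{h, f₁} = 0` and `{h, f₂} = 0`; i.e. `h`
is a t-independent constant of motion for the Lie system
`X = b₁(t)X_{f₁} + b₂(t)X_{f₂}`. -/
theorem stmt_16 (b : ℝ) (hb : b ≠ 0) (p : Fin 3 → ℝ)
    (hp : p ∈ {q : Fin 3 → ℝ | 0 < q 0}) :
    jb (Lam b) (Evec b) f₁ (f₂ b) p = f₁ p ∧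
    jb (Lam b) (Evec b) (h b) f₁ p = 0 ∧
    jb (Lam b) (Evec b) (h b) (f₂ b) p = 0 := by
  have hx : p 0 ≠ 0 := ne_of_gt hp
  have hexp : exp (b * (p 1 - p 2)) * exp (-b * (p 1 - p 2)) = 1 := by
    rw [← Real.exp_add, neg_mul, add_neg_cancel, Real.exp_zero]
  simp only [jb, Fin.sum_univ_three, pd_f₁, pd_f₂ b _ hx, pd_h]
  simp only [Lam, Evec, f₁, f₂, h, Matrix.cons_val]
  refine ⟨?_, ?_, ?_⟩
  · field_simp
    ring
  · linear_combination b * hexp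
  · generalize exp (-b * (p 1 - p 2)) = e at *
    field_simp
    linear_combination -(Real.log (p 0) + 1) * 2 * b * hexp
end
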